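/- Let 𝒫 be an imprecise probability tree and Q̄ an upper expectation tree that agree. Then for every situation s and every global variable f: Ω → ℝ̄ that is either upper semicontinuous and bounded above, or lower semicontinuous and bounded below, Ē_𝒫(f|s) = Ē_Q̄(f|s). -/

import Mathlib

open Filter MeasureTheory Topology
open scoped ENNReal

namespace UEPaper

variable {X : Type} [Fintype X] [Nonempty X] [DecidableEq X]

/-- The set of paths: infinite sequences of states (`ω i` is the `(i+1)`-th state). -/
abbrev Path (X : Type) := ℕ → X

/-- The prefix `ω^k` of length `k` of a path, as a list (a situation). -/
def prefixList (ω : Path X) (k : ℕ) : List X := (List.range k).map ω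

/-- The cylinder event `Γ(s)` of a situation `s`. -/
def cyl (s : List X) : Set (Path X) := {ω | prefixList ω s.length = s}

/-- `f` is `n`-measurable: it depends only on the first `n` states. -/
def NMeas (n : ℕ) (f : Path X → EReal) : Prop :=
  ∀ ω ω' : Path X, prefixList ω n = prefixList ω' n → f ω = f ω'

/-- A gamble: a bounded real-valued global variable. -/
def IsGamble (f : Path X → EReal) : Prop :=
  ∃ B : ℝ, ∀ ω, -(B : EReal) ≤ f ω ∧ f ω ≤ (B : EReal)

/-- A finitary gamble: an `n`-measurable gamble for some `n`. -/
def IsFinGamble (f : Path X → EReal) : Prop :=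
  (∃ n, NMeas n f) ∧ IsGamble f

/-- An upper expectation tree: a coherent upper expectation at each situation. -/
structure UpperExpTree (X : Type) [Fintype X] [Nonempty X] where
  Q : List X → (X → ℝ) → ℝ
  le_sup : ∀ (s : List X) (f : X → ℝ), Q s f ≤ ⨆ x, f x
  subadd : ∀ (s : List X) (f g : X → ℝ), Q s (f + g) ≤ Q s f + Q s g
  pos_homog : ∀ (s : List X) (l : ℝ) (f : X → ℝ), 0 ≤ l → Q s (l • f) = l * Q s f

/-- A (real-valued) supermartingale for the upper expectation tree `Q`. -/
def IsSupermart (Q : UpperExpTree X) (M : List X → ℝ) : Prop :=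
  ∀ s : List X, Q.Q s (fun x => M (s ++ [x])) ≤ M s

/-- The game-theoretic upper expectation of a real-valued variable (used on gambles):
the infimum of `M s` over bounded-below supermartingales `M` with
`liminf_k M(ω^k) ≥ f(ω)` on `Γ(s)`. -/
noncomputable def gtG (Q : UpperExpTree X) (f : Path X → ℝ) (s : List X) : EReal :=
  sInf {a : EReal | ∃ M : List X → ℝ, IsSupermart Q M ∧ (∃ B : ℝ, ∀ t, B ≤ M t) ∧
    (∀ ω ∈ cyl s,
      (f ω : EReal) ≤ Filter.liminf (fun k => ((M (prefixList ω k) : ℝ) : EReal)) atTop) ∧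
    a = ((M s : ℝ) : EReal)}

/-- Extension to bounded-below variables, by continuity w.r.t. upper cuts:
`Ē(f|s) = lim_{c → +∞} Ē(min(f,c)|s)` (the limit of this nondecreasing net is a supremum). -/
noncomputable def gtBB (Q : UpperExpTree X) (f : Path X → EReal) (s : List X) : EReal :=
  ⨆ c : ℝ, gtG Q (fun ω => (f ω ⊓ (c : EReal)).toReal) s

/-- The game-theoretic global upper expectation `Ē_Q̄`, extended to all extended
real variables by continuity w.r.t. lower cuts:
`Ē(f|s) = lim_{c → −∞} Ē(max(f,c)|s)` (the limit of this nonincreasing net is an infimum). -/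
noncomputable def gtUE (Q : UpperExpTree X) (f : Path X → EReal) (s : List X) : EReal :=
  ⨅ c : ℝ, gtBB Q (fun ω => f ω ⊔ (c : EReal)) s

/-- A precise probability tree: a probability mass function at each situation. -/
structure PreciseTree (X : Type) [Fintype X] where
  p : List X → X → ℝ
  nonneg : ∀ (s : List X) (x : X), 0 ≤ p s x
  sum_one : ∀ s : List X, ∑ x, p s x = 1

/-- An imprecise probability tree: a nonempty closed convex set of probability mass
functions at each situation. -/
structure ImpreciseTree (X : Type) [Fintype X] where
  sets : List X → Set (X → ℝ)
  nonempty' : ∀ s : List X, (sets s).Nonempty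
  closed' : ∀ s : List X, IsClosed (sets s)
  convex' : ∀ s : List X, Convex ℝ (sets s)
  prob' : ∀ s : List X, ∀ q ∈ sets s, (∀ x, 0 ≤ q x) ∧ ∑ x, q x = 1

/-- `p ∼ 𝒫`: the precise tree `p` is compatible with the imprecise tree `P`. -/
def Compatible (p : PreciseTree X) (P : ImpreciseTree X) : Prop :=
  ∀ s : List X, p.p s ∈ P.sets s

/-- The probability `P_p(Γ(z)|s)` of the cylinder of `z` conditional on situation `s`. -/
noncomputable def cylProb (p : List X → X → ℝ) (s z : List X) : ℝ :=
  if s.length < z.length ∧ z.take s.length = s then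
    ∏ i ∈ Finset.Ico s.length z.length, p (z.take i) (z.getD i (Classical.arbitrary X))
  else if z.length ≤ s.length ∧ s.take z.length = z then 1 else 0

/-- The σ-algebra `ℱ` on paths generated by the cylinder events. -/
instance cylSigma : MeasurableSpace (Path X) :=
  MeasurableSpace.generateFrom {A | ∃ s : List X, A = cyl s}

/-- `μ` is the probability measure `P_p(·|s)` on `ℱ` determined by the tree `p`. -/
def IsTreeMeasure (p : PreciseTree X) (s : List X) (μ : Measure (Path X)) : Prop :=
  IsProbabilityMeasure μ ∧ ∀ z : List X, μ (cyl z) = ENNReal.ofReal (cylProb p.p s z)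

/-- Positive part of an extended real, in `ℝ≥0∞`. -/
noncomputable def posPart (x : EReal) : ℝ≥0∞ := if x = ⊤ then ⊤ else ENNReal.ofReal x.toReal

/-- The Lebesgue integral `∫ g dμ = ∫ g⁺ dμ − ∫ g⁻ dμ` of an extended-real variable
(well-defined, with value in `(-∞, +∞]`, for bounded-below measurable `g`). -/
noncomputable def integralE (μ : Measure (Path X)) (g : Path X → EReal) : EReal :=
  ((∫⁻ ω, posPart (g ω) ∂μ : ℝ≥0∞) : EReal) - ((∫⁻ ω, posPart (-(g ω)) ∂μ : ℝ≥0∞) : EReal)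

/-- The upper integral `Ē_p(f|s)`: infimum of integrals of bounded-below
`ℱ`-measurable variables dominating `f`. -/
noncomputable def upperInt (μ : Measure (Path X)) (f : Path X → EReal) : EReal :=
  sInf {a : EReal | ∃ g : Path X → EReal, Measurable g ∧ (∃ B : ℝ, ∀ ω, (B : EReal) ≤ g ω) ∧
    (∀ ω, f ω ≤ g ω) ∧ a = integralE μ g}

/-- The measure-theoretic global upper expectation `Ē_𝒫(f|s)`, given the assignment
`Pm` of the measures `P_p(·|s)` to precise trees: the upper envelope of the upper
integrals over all compatible precise trees. -/
noncomputable def muUE (Pm : PreciseTree X → List X → Measure (Path X))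
    (P : ImpreciseTree X) (f : Path X → EReal) (s : List X) : EReal :=
  ⨆ (p : PreciseTree X) (_ : Compatible p P), upperInt (Pm p s) f

/-- The trees `P` and `Q` agree: each `Q̄_s` is the upper envelope of the expectations
corresponding to the credal set `𝒫_s`. -/
def Agree (P : ImpreciseTree X) (Q : UpperExpTree X) : Prop :=
  ∀ (s : List X) (f : X → ℝ),
    Q.Q s f = sSup {r : ℝ | ∃ q ∈ P.sets s, r = ∑ x, f x * q x}

/-- Axioms P1–P5 for a global upper expectation `E` w.r.t. the tree `Q`. -/
structure Axioms (Q : UpperExpTree X) (E : (Path X → EReal) → List X → EReal) : Prop where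
  p1 : ∀ (f : X → ℝ) (s : List X),
    E (fun ω => ((f (ω s.length) : ℝ) : EReal)) s = ((Q.Q s f : ℝ) : EReal)
  p2 : ∀ f : Path X → EReal, IsFinGamble f → ∀ s : List X, E f s = E ((cyl s).indicator f) s
  p3 : ∀ f : Path X → EReal, IsFinGamble f → ∀ s : List X,
    E f s ≤ E (fun ω => E f (prefixList ω (s.length + 1))) s
  p4 : ∀ f g : Path X → EReal, (∀ ω, f ω ≤ g ω) → ∀ s : List X, E f s ≤ E g s
  p5 : ∀ (s : List X) (fn : ℕ → Path X → EReal) (f : Path X → EReal),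
    (∀ n, IsFinGamble (fn n)) → (∃ B : ℝ, ∀ n ω, (B : EReal) ≤ fn n ω) →
    (∀ ω, Tendsto (fun n => fn n ω) atTop (nhds (f ω))) →
    E f s ≤ limsup (fun n => E (fn n) s) atTop

/-- Upper semicontinuity of an extended-real variable on the path space. -/
def USC [TopologicalSpace X] [DiscreteTopology X] (f : Path X → EReal) : Prop :=
  ∀ a : ℝ, IsOpen {ω : Path X | f ω < (a : EReal)}

/-- An `Ω`-capacity (Dellacherie): a monotone `[0,∞]`-valued functional on nonnegative
variables, continuous along nondecreasing sequences, and continuous along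
nonincreasing sequences of nonnegative real-valued upper semicontinuous functions. -/
def IsCapacity [TopologicalSpace X] [DiscreteTopology X]
    (F : (Path X → EReal) → EReal) : Prop :=
  (∀ f : Path X → EReal, (∀ ω, 0 ≤ f ω) → 0 ≤ F f) ∧
  (∀ f g : Path X → EReal, (∀ ω, 0 ≤ f ω) → (∀ ω, 0 ≤ g ω) → (∀ ω, f ω ≤ g ω) → F f ≤ F g) ∧
  (∀ fn : ℕ → Path X → EReal, (∀ n ω, 0 ≤ fn n ω) → Monotone fn →
    Tendsto (fun n => F (fn n)) atTop (nhds (F (fun ω => ⨆ n, fn n ω)))) ∧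
  (∀ fn : ℕ → Path X → EReal, (∀ n ω, 0 ≤ fn n ω ∧ fn n ω < ⊤) → (∀ n, USC (fn n)) →
    Antitone fn →
    Tendsto (fun n => F (fn n)) atTop (nhds (F (fun ω => ⨅ n, fn n ω))))

open Classical in
/-- The metric `δ(ω,ω') = 2^{-n}`, `n` the first (1-based) index where `ω` and `ω'` differ. -/
noncomputable def delta (ω ω' : Path X) : ℝ :=
  if h : ω = ω' then 0
  else (1 / 2 : ℝ) ^ (Nat.find (Function.ne_iff.mp h) + 1)

/-- The product topology on the path space (with `X` discrete). -/
def prodTop (X : Type) : TopologicalSpace (ℕ → X) :=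
  @Pi.topologicalSpace ℕ (fun _ => X) (fun _ => ⊥)

section Operators

omit [Fintype X] [Nonempty X] [DecidableEq X] in
lemma length_prefixList (ω : Path X) (k : ℕ) : (prefixList ω k).length = k := by
  simp [prefixList]

omit [Fintype X] [Nonempty X] [DecidableEq X] in
lemma prefixList_succ (ω : Path X) (k : ℕ) :
    prefixList ω (k + 1) = prefixList ω k ++ [ω k] := by
  simp [prefixList, List.range_succ]

omit [Fintype X] [Nonempty X] [DecidableEq X] in
lemma mem_cyl_prefixList (ω : Path X) (k : ℕ) : ω ∈ cyl (prefixList ω k) := by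
  simp [cyl, length_prefixList]

omit [Fintype X] [Nonempty X] [DecidableEq X] in
lemma mem_cyl_append {ω : Path X} {t : List X} {x : X} :
    ω ∈ cyl (t ++ [x]) ↔ ω ∈ cyl t ∧ ω t.length = x := by
  have h : (prefixList ω t.length).length = t.length := length_prefixList ω _
  change prefixList ω (t ++ [x]).length = t ++ [x] ↔ prefixList ω t.length = t ∧ ω t.length = x
  rw [List.length_append, List.length_singleton, prefixList_succ]
  refine ⟨fun e => ?_, fun ⟨e₁, e₂⟩ => by rw [e₁, e₂]⟩
  obtain ⟨e₁, e₂⟩ := List.append_inj e h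
  exact ⟨e₁, List.singleton_inj.1 e₂⟩

omit [Fintype X] [Nonempty X] [DecidableEq X] in
lemma cyl_append_subset (t : List X) (x : X) : cyl (t ++ [x]) ⊆ cyl t :=
  fun _ h => (mem_cyl_append.1 h).1

omit [Fintype X] [Nonempty X] [DecidableEq X] in
lemma cyl_eq_iUnion (t : List X) : cyl t = ⋃ x : X, cyl (t ++ [x]) := by
  ext ω
  simp [mem_cyl_append]

omit [Fintype X] [Nonempty X] [DecidableEq X] in
lemma pairwise_disjoint_cyl_append (t : List X) :
    Pairwise (Function.onFun Disjoint fun x : X => cyl (t ++ [x])) := by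
  intro x y hxy
  refine Set.disjoint_left.2 fun ω hx hy => hxy ?_
  rw [← (mem_cyl_append.1 hx).2, ← (mem_cyl_append.1 hy).2]

/-- One step of backward recursion with the upper expectation tree `Q`. -/
def upperStep (Q : UpperExpTree X) (φ : List X → ℝ) (t : List X) : ℝ :=
  Q.Q t fun x => φ (t ++ [x])

/-- One step of backward recursion with the precise tree `p`. -/
def expStep (p : PreciseTree X) (φ : List X → ℝ) (t : List X) : ℝ :=
  ∑ x, φ (t ++ [x]) * p.p t x

omit [Nonempty X] [DecidableEq X] in
lemma expStep_mono (p : PreciseTree X) : Monotone (expStep p) :=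
  fun _ _ h t => Finset.sum_le_sum fun _ _ => mul_le_mul_of_nonneg_right (h _) (p.nonneg t _)

omit [Nonempty X] [DecidableEq X] in
lemma expStep_add_const (p : PreciseTree X) (φ : List X → ℝ) (b : ℝ) :
    expStep p (fun t => φ t + b) = fun t => expStep p φ t + b := by
  ext t
  simp [expStep, add_mul, Finset.sum_add_distrib, ← Finset.mul_sum, p.sum_one]

omit [Nonempty X] [DecidableEq X] in
lemma iterate_expStep_add_const (p : PreciseTree X) (φ : List X → ℝ) (b : ℝ) (n : ℕ) :
    (expStep p)^[n] (fun t => φ t + b) = fun t => (expStep p)^[n] φ t + b := by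
  induction n with
  | zero => rfl
  | succ n ih =>
    rw [Function.iterate_succ_apply', ih, expStep_add_const, Function.iterate_succ_apply']

omit [Nonempty X] [DecidableEq X] in
lemma iterate_expStep_nonneg (p : PreciseTree X) {φ : List X → ℝ} (h : ∀ t, 0 ≤ φ t) (n : ℕ)
    (t : List X) : 0 ≤ (expStep p)^[n] φ t := by
  induction n generalizing t with
  | zero => exact h t
  | succ n ih =>
    rw [Function.iterate_succ_apply']
    exact Finset.sum_nonneg fun x _ => mul_nonneg (ih _) (p.nonneg t x)

omit [Nonempty X] [DecidableEq X] in
lemma tendsto_iterate_expStep (p : PreciseTree X) {ι : Type*} {l : Filter ι}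
    {g : ι → List X → ℝ} {φ : List X → ℝ} (h : ∀ t, Tendsto (fun i => g i t) l (𝓝 (φ t)))
    (n : ℕ) (t : List X) :
    Tendsto (fun i => (expStep p)^[n] (g i) t) l (𝓝 ((expStep p)^[n] φ t)) := by
  induction n generalizing t with
  | zero => exact h t
  | succ n ih =>
    simp only [Function.iterate_succ_apply']
    exact tendsto_finsetSum _ fun x _ => (ih _).mul_const _

variable {P : ImpreciseTree X} {Q : UpperExpTree X}

omit [Nonempty X] [DecidableEq X] in
lemma isCompact_sets (P : ImpreciseTree X) (t : List X) : IsCompact (P.sets t) := by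
  refine (isCompact_Icc (a := (0 : X → ℝ)) (b := 1)).of_isClosed_subset (P.closed' t) ?_
  intro q hq
  obtain ⟨h0, h1⟩ := P.prob' t q hq
  refine ⟨h0, fun x => ?_⟩
  calc q x ≤ ∑ y, q y := Finset.single_le_sum (fun y _ => h0 y) (Finset.mem_univ x)
    _ = 1 := h1

omit [DecidableEq X] in
lemma exists_isMax_sets (hagree : Agree P Q) (t : List X) (f : X → ℝ) :
    ∃ q ∈ P.sets t, Q.Q t f = ∑ x, f x * q x ∧ ∀ r ∈ P.sets t, ∑ x, f x * r x ≤ Q.Q t f := by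
  have hc : ContinuousOn (fun q : X → ℝ => ∑ x, f x * q x) (P.sets t) := by fun_prop
  obtain ⟨q, hq, hmax⟩ := (isCompact_sets P t).exists_isMaxOn (P.nonempty' t) hc
  have hg : IsGreatest {r : ℝ | ∃ q ∈ P.sets t, r = ∑ x, f x * q x} (∑ x, f x * q x) := by
    refine ⟨⟨q, hq, rfl⟩, ?_⟩
    rintro _ ⟨r, hr, rfl⟩
    exact hmax hr
  have h : Q.Q t f = ∑ x, f x * q x := by rw [hagree t f, hg.csSup_eq]
  exact ⟨q, hq, h, fun r hr => h ▸ hmax hr⟩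

omit [DecidableEq X] in
lemma expStep_le_upperStep (hagree : Agree P Q) {p : PreciseTree X} (hp : Compatible p P)
    (φ : List X → ℝ) : expStep p φ ≤ upperStep Q φ := by
  intro t
  obtain ⟨q, -, -, h⟩ := exists_isMax_sets hagree t fun x => φ (t ++ [x])
  exact h _ (hp t)

omit [DecidableEq X] in
/-- A precise tree attaining the upper expectations of a prescribed gamble in each situation. -/
lemma exists_compatible_attaining (hagree : Agree P Q) (g : List X → X → ℝ) :
    ∃ p : PreciseTree X, Compatible p P ∧ ∀ t, Q.Q t (g t) = ∑ x, g t x * p.p t x := by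
  choose q hq h _ using fun t => exists_isMax_sets hagree t (g t)
  exact ⟨⟨q, fun t => (P.prob' t _ (hq t)).1, fun t => (P.prob' t _ (hq t)).2⟩, hq, h⟩

omit [DecidableEq X] in
lemma exists_expStep_eq (hagree : Agree P Q) (φ : List X → ℝ) :
    ∃ p : PreciseTree X, Compatible p P ∧ upperStep Q φ = expStep p φ := by
  obtain ⟨p, hp, h⟩ := exists_compatible_attaining hagree fun t x => φ (t ++ [x])
  exact ⟨p, hp, funext h⟩

omit [DecidableEq X] in
lemma upperStep_mono (hagree : Agree P Q) : Monotone (upperStep Q) := by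
  intro φ ψ h
  obtain ⟨p, hp, hφ⟩ := exists_expStep_eq hagree φ
  rw [hφ]
  exact (expStep_mono p h).trans (expStep_le_upperStep hagree hp ψ)

omit [DecidableEq X] in
lemma upperStep_const (hagree : Agree P Q) (b : ℝ) :
    upperStep Q (fun _ => b) = fun _ => b := by
  obtain ⟨p, -, h⟩ := exists_expStep_eq hagree fun _ => b
  rw [h]
  ext t
  simp [expStep, ← Finset.mul_sum, p.sum_one]

omit [DecidableEq X] in
lemma upperStep_le_self (hagree : Agree P Q) {φ : List X → ℝ}
    (hφ : ∀ t x, φ (t ++ [x]) ≤ φ t) : upperStep Q φ ≤ φ := by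
  obtain ⟨p, -, h⟩ := exists_expStep_eq hagree φ
  rw [h]
  intro t
  calc expStep p φ t ≤ ∑ x, φ t * p.p t x :=
        Finset.sum_le_sum fun x _ => mul_le_mul_of_nonneg_right (hφ t x) (p.nonneg t x)
    _ = φ t := by rw [← Finset.mul_sum, p.sum_one, mul_one]

omit [DecidableEq X] in
lemma le_upperStep_self (hagree : Agree P Q) {φ : List X → ℝ}
    (hφ : ∀ t x, φ t ≤ φ (t ++ [x])) : φ ≤ upperStep Q φ := by
  obtain ⟨p, -, h⟩ := exists_expStep_eq hagree φ
  rw [h]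
  intro t
  calc φ t = ∑ x, φ t * p.p t x := by rw [← Finset.mul_sum, p.sum_one, mul_one]
    _ ≤ expStep p φ t :=
        Finset.sum_le_sum fun x _ => mul_le_mul_of_nonneg_right (hφ t x) (p.nonneg t x)

omit [DecidableEq X] in
lemma iterate_upperStep_const (hagree : Agree P Q) (b : ℝ) (n : ℕ) :
    (upperStep Q)^[n] (fun _ => b) = fun _ => b :=
  Function.iterate_fixed (upperStep_const hagree b) n

omit [DecidableEq X] in
lemma iterate_upperStep_congr (Q : UpperExpTree X) {φ ψ : List X → ℝ} (n : ℕ) (t : List X)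
    (h : ∀ u, u.length = t.length + n → φ u = ψ u) :
    (upperStep Q)^[n] φ t = (upperStep Q)^[n] ψ t := by
  induction n generalizing t with
  | zero => exact h t rfl
  | succ n ih =>
    simp only [Function.iterate_succ_apply', upperStep]
    congr 1
    ext x
    exact ih _ fun u hu => h u (by simp at hu; omega)

omit [DecidableEq X] in
lemma isSupermart_iff {M : List X → ℝ} : IsSupermart Q M ↔ upperStep Q M ≤ M := Iff.rfl

omit [DecidableEq X] in
/-- Backward recursion from level `L` yields a supermartingale, provided the terminal values
already form a supermartingale. -/
lemma isSupermart_iterate {φ : List X → ℝ} (h : upperStep Q φ ≤ φ) (L : ℕ) :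
    IsSupermart Q fun t => (upperStep Q)^[L - t.length] φ t := by
  intro t
  simp only [List.length_append, List.length_singleton]
  rcases lt_or_ge t.length L with hL | hL
  · obtain ⟨j, hj⟩ : ∃ j, L - t.length = j + 1 := ⟨L - t.length - 1, by omega⟩
    rw [hj, show L - (t.length + 1) = j by omega, Function.iterate_succ_apply']
    rfl
  · rw [show L - t.length = 0 by omega, show L - (t.length + 1) = 0 by omega]
    exact h t

omit [DecidableEq X] in
/-- For each depth, some compatible precise tree attains the backward recursion. -/
lemma exists_iterate_expStep_eq (hagree : Agree P Q) (φ : List X → ℝ) (n : ℕ) (s : List X) :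
    ∃ p : PreciseTree X, Compatible p P ∧ (expStep p)^[n] φ s = (upperStep Q)^[n] φ s := by
  obtain ⟨p, hp, h⟩ := exists_compatible_attaining hagree fun t x =>
    (upperStep Q)^[s.length + n - (t.length + 1)] φ (t ++ [x])
  refine ⟨p, hp, ?_⟩
  have key : ∀ k, ∀ t : List X, t.length + k = s.length + n →
      (expStep p)^[k] φ t = (upperStep Q)^[k] φ t := by
    intro k
    induction k with
    | zero => intro t _; rfl
    | succ k ih =>
      intro t ht
      have ht' := h t
      rw [show s.length + n - (t.length + 1) = k by omega] at ht'
      rw [Function.iterate_succ_apply', Function.iterate_succ_apply']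
      refine Eq.trans ?_ ht'.symm
      refine Finset.sum_congr rfl fun x _ => ?_
      rw [ih (t ++ [x]) (by simp; omega)]
  exact key n s rfl

omit [DecidableEq X] in
/-- When the terminal values decrease along `upperStep`, a single compatible precise tree
dominates all backward recursions simultaneously. -/
lemma exists_compatible_le_iterate_expStep (hagree : Agree P Q) {φ : List X → ℝ}
    (hφ : upperStep Q φ ≤ φ) (s : List X) {a : ℝ} (ha : ∀ k, a ≤ (upperStep Q)^[k] φ s) :
    ∃ p : PreciseTree X, Compatible p P ∧ ∀ n, a ≤ (expStep p)^[n] φ s := by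
  have hanti : Antitone fun k => (upperStep Q)^[k] φ :=
    (upperStep_mono hagree).antitone_iterate_of_map_le hφ
  choose q hqc hq using fun k => exists_expStep_eq hagree ((upperStep Q)^[k] φ)
  let U : Ultrafilter ℕ := hyperfilter ℕ
  have hU : (U : Filter ℕ) ≤ atTop := by
    rw [← Nat.cofinite_eq_atTop]; exact hyperfilter_le_cofinite
  have hlim : ∀ t, ∃ r ∈ P.sets t, Tendsto (fun k => (q k).p t) U (𝓝 r) := fun t =>
    (isCompact_sets P t).ultrafilter_le_nhds' (U.map fun k => (q k).p t)
      (Ultrafilter.mem_map.2 (Filter.univ_mem' fun k => hqc k t))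
  choose r hr hrlim using hlim
  refine ⟨⟨r, fun t => (P.prob' t _ (hr t)).1, fun t => (P.prob' t _ (hr t)).2⟩, hr, ?_⟩
  set p : PreciseTree X :=
    ⟨r, fun t => (P.prob' t _ (hr t)).1, fun t => (P.prob' t _ (hr t)).2⟩
  have key : ∀ n j, a ≤ (expStep p)^[n] ((upperStep Q)^[j] φ) s := by
    intro n
    induction n with
    | zero => exact ha
    | succ n ih =>
      intro j
      have hstep : ∀ t, Tendsto (fun k => expStep (q k) ((upperStep Q)^[j] φ) t) U
          (𝓝 (expStep p ((upperStep Q)^[j] φ) t)) := fun t =>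
        tendsto_finsetSum _ fun x _ => (tendsto_pi_nhds.1 (hrlim t) x).const_mul _
      rw [Function.iterate_succ_apply]
      refine ge_of_tendsto (tendsto_iterate_expStep p hstep n s) ?_
      filter_upwards [hU (eventually_ge_atTop j)] with k hk
      refine (ih (k + 1)).trans ((expStep_mono p).iterate n ?_ s)
      rw [Function.iterate_succ_apply', hq k]
      exact expStep_mono (q k) (hanti hk)
  exact fun n => key n 0

omit [DecidableEq X] in
/-- When the terminal values increase along `upperStep`, the limit of the backward recursions
is a supermartingale. -/
lemma isSupermart_iSup_iterate (hagree : Agree P Q) {φ : List X → ℝ} (hφ : φ ≤ upperStep Q φ)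
    {B : ℝ} (hB : ∀ t, φ t ≤ B) : IsSupermart Q fun t => ⨆ k, (upperStep Q)^[k] φ t := by
  have hmono : Monotone fun k => (upperStep Q)^[k] φ :=
    (upperStep_mono hagree).monotone_iterate_of_le_map hφ
  have hle : ∀ k t, (upperStep Q)^[k] φ t ≤ B := by
    intro k t
    refine ((upperStep_mono hagree).iterate k (show φ ≤ fun _ => B from hB) t).trans_eq ?_
    rw [iterate_upperStep_const hagree]
  have hbdd : ∀ t, BddAbove (Set.range fun k => (upperStep Q)^[k] φ t) :=
    fun t => ⟨B, by rintro _ ⟨k, rfl⟩; exact hle k t⟩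
  have hlim : ∀ t, Tendsto (fun k => (upperStep Q)^[k] φ t) atTop
      (𝓝 (⨆ k, (upperStep Q)^[k] φ t)) :=
    fun t => tendsto_atTop_ciSup (fun _ _ h => hmono h t) (hbdd t)
  obtain ⟨p, hp, h⟩ := exists_expStep_eq hagree fun t => ⨆ k, (upperStep Q)^[k] φ t
  rw [isSupermart_iff, h]
  intro t
  refine le_of_tendsto (tendsto_iterate_expStep p hlim 1 t) (Eventually.of_forall fun k => ?_)
  refine (expStep_le_upperStep hagree hp _ t).trans ?_
  rw [← Function.iterate_succ_apply' (upperStep Q)]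
  exact le_ciSup (hbdd t) (k + 1)

end Operators

section Measure

omit [Fintype X] [Nonempty X] [DecidableEq X] in
lemma measurableSet_cyl (t : List X) : MeasurableSet (cyl t) :=
  MeasurableSpace.measurableSet_generateFrom ⟨t, rfl⟩

omit [Nonempty X] [DecidableEq X] in
lemma measurable_comp_prefixList {β : Type*} [MeasurableSpace β] (ψ : List X → β) (n : ℕ) :
    Measurable fun ω : Path X => ψ (prefixList ω n) := by
  let _ : MeasurableSpace (List X) := ⊤
  have h : Measurable fun ω : Path X => prefixList ω n := by
    refine measurable_to_countable' fun t => ?_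
    by_cases ht : t.length = n
    · subst ht
      exact measurableSet_cyl t
    · convert MeasurableSet.empty
      ext ω
      simp only [Set.mem_preimage, Set.mem_singleton_iff, Set.mem_empty_iff_false, iff_false]
      rintro rfl
      exact ht (length_prefixList ω n)
  exact measurable_from_top.comp h

omit [Fintype X] in
lemma cylProb_append (p : List X → X → ℝ) {s t : List X} (h : s <+: t) (x : X) :
    cylProb p s (t ++ [x]) = cylProb p s t * p t x := by
  obtain ⟨u, rfl⟩ := h
  have htake : ((s ++ u) ++ [x]).take s.length = s := by simp
  have hprod : cylProb p s (s ++ u) = ∏ i ∈ Finset.Ico s.length (s ++ u).length,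
      p ((s ++ u).take i) ((s ++ u).getD i (Classical.arbitrary X)) := by
    rcases eq_or_ne u [] with rfl | hu
    · simp [cylProb]
    · have : 0 < u.length := List.length_pos_iff.2 hu
      rw [cylProb, if_pos]
      simp [this]
  rw [hprod, cylProb, if_pos ⟨by simp, htake⟩, List.length_append (bs := [x]),
    List.length_singleton, Finset.prod_Ico_succ_top (by simp)]
  congr 1
  · refine Finset.prod_congr rfl fun i hi => ?_
    have hi' := (Finset.mem_Ico.1 hi).2
    rw [List.take_append_of_le_length hi'.le, List.getD_append _ _ _ _ hi']
  · rw [List.take_left' rfl, List.getD_append_right _ _ _ _ le_rfl]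
    simp

omit [Fintype X] in
lemma cylProb_self (p : List X → X → ℝ) (s : List X) : cylProb p s s = 1 := by
  simp [cylProb]

omit [Fintype X] in
lemma cylProb_nonneg {p : List X → X → ℝ} (hp : ∀ t x, 0 ≤ p t x) (s t : List X) :
    0 ≤ cylProb p s t := by
  unfold cylProb
  split_ifs
  · exact Finset.prod_nonneg fun _ _ => hp _ _
  · exact zero_le_one
  · exact le_rfl

variable {p : PreciseTree X} {s : List X} {μ : Measure (Path X)}

lemma IsTreeMeasure.cyl_append (hμ : IsTreeMeasure p s μ) {t : List X} (h : s <+: t) (x : X) :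
    μ (cyl (t ++ [x])) = μ (cyl t) * ENNReal.ofReal (p.p t x) := by
  rw [hμ.2, hμ.2, cylProb_append p.p h, ENNReal.ofReal_mul (cylProb_nonneg p.nonneg s t)]

lemma IsTreeMeasure.ae_mem_cyl (hμ : IsTreeMeasure p s μ) : ∀ᵐ ω ∂μ, ω ∈ cyl s := by
  have := hμ.1
  refine (prob_compl_eq_zero_iff (measurableSet_cyl s)).2 ?_
  rw [hμ.2, cylProb_self, ENNReal.ofReal_one]

lemma IsTreeMeasure.setLIntegral_prefixList (hμ : IsTreeMeasure p s μ) {ψ : List X → ℝ}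
    (hψ : ∀ t, 0 ≤ ψ t) (n : ℕ) {t : List X} (h : s <+: t) :
    ∫⁻ ω in cyl t, ENNReal.ofReal (ψ (prefixList ω (t.length + n))) ∂μ =
      μ (cyl t) * ENNReal.ofReal ((expStep p)^[n] ψ t) := by
  induction n generalizing t with
  | zero =>
    have : Set.EqOn (fun ω => ENNReal.ofReal (ψ (prefixList ω (t.length + 0))))
        (fun _ => ENNReal.ofReal (ψ t)) (cyl t) := fun ω hω => by
      have hω' : prefixList ω t.length = t := hω
      simp [hω']
    rw [setLIntegral_congr_fun (measurableSet_cyl t) this, setLIntegral_const, mul_comm]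
    rfl
  | succ n ih =>
    have hx : ∀ x, ∫⁻ ω in cyl (t ++ [x]),
        ENNReal.ofReal (ψ (prefixList ω (t.length + (n + 1)))) ∂μ =
        μ (cyl t) * ENNReal.ofReal ((expStep p)^[n] ψ (t ++ [x]) * p.p t x) := by
      intro x
      have := ih (t := t ++ [x]) (h.trans (List.prefix_append _ _))
      rw [List.length_append, List.length_singleton, add_assoc, add_comm 1 n] at this
      rw [this, hμ.cyl_append h, ENNReal.ofReal_mul (iterate_expStep_nonneg p hψ n _)]
      ring
    conv_lhs => rw [cyl_eq_iUnion t]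
    rw [lintegral_iUnion (fun x => measurableSet_cyl _) (pairwise_disjoint_cyl_append t),
      tsum_fintype, Finset.sum_congr rfl fun x _ => hx x, ← Finset.mul_sum,
      Function.iterate_succ_apply',
      ← ENNReal.ofReal_sum_of_nonneg fun x _ =>
        mul_nonneg (iterate_expStep_nonneg p hψ n _) (p.nonneg t x)]
    rfl

lemma IsTreeMeasure.lintegral_prefixList (hμ : IsTreeMeasure p s μ) {ψ : List X → ℝ}
    (hψ : ∀ t, 0 ≤ ψ t) (n : ℕ) :
    ∫⁻ ω, ENNReal.ofReal (ψ (prefixList ω (s.length + n))) ∂μ =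
      ENNReal.ofReal ((expStep p)^[n] ψ s) := by
  rw [← Measure.restrict_eq_self_of_ae_mem hμ.ae_mem_cyl,
    hμ.setLIntegral_prefixList hψ n List.prefix_rfl, hμ.2, cylProb_self]
  simp

omit [Fintype X] [Nonempty X] [DecidableEq X] in
lemma integralE_eq [IsProbabilityMeasure μ] {g : Path X → EReal} (hg : Measurable g) {b : ℝ}
    (hb : 0 ≤ b) (hgb : ∀ ω, ((-b : ℝ) : EReal) ≤ g ω) :
    integralE μ g = ((∫⁻ ω, (g ω + b).toENNReal ∂μ : ℝ≥0∞) : EReal) - b := by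
  have hpos : ∀ x, posPart x = x.toENNReal := fun _ => rfl
  have hpt : ∀ ω, (g ω).toENNReal + ENNReal.ofReal b =
      (g ω + b).toENNReal + (-(g ω)).toENNReal := by
    intro ω
    have h := hgb ω
    induction hx : g ω with
    | bot => simp [hx] at h
    | top => simp
    | coe x =>
      rw [hx, EReal.coe_le_coe_iff] at h
      rw [← EReal.coe_add, ← EReal.coe_neg]
      simp only [EReal.toENNReal_of_ne_top (EReal.coe_ne_top _), EReal.toReal_coe]
      rcases le_total 0 x with hx0 | hx0
      · rw [ENNReal.ofReal_of_nonpos (neg_nonpos.2 hx0), add_zero, ENNReal.ofReal_add hx0 hb]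
      · rw [ENNReal.ofReal_of_nonpos hx0, zero_add, ← ENNReal.ofReal_add (by linarith) (by linarith)]
        congr 1
        ring
  have hneg : ∫⁻ ω, (-(g ω)).toENNReal ∂μ ≤ ENNReal.ofReal b := by
    calc ∫⁻ ω, (-(g ω)).toENNReal ∂μ ≤ ∫⁻ _, ENNReal.ofReal b ∂μ := by
          refine lintegral_mono fun ω => ?_
          have h : -(g ω) ≤ (b : EReal) := by
            rw [EReal.neg_le, ← EReal.coe_neg]; exact hgb ω
          exact (EReal.toENNReal_le_toENNReal h).trans_eq (by simp [EReal.toENNReal_of_ne_top])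
      _ = ENNReal.ofReal b := by simp
  have hmeas : Measurable fun ω => (-(g ω)).toENNReal :=
    measurable_ereal_toENNReal.comp hg.neg
  have hsum : ∫⁻ ω, (g ω).toENNReal ∂μ + ENNReal.ofReal b =
      ∫⁻ ω, (g ω + b).toENNReal ∂μ + ∫⁻ ω, (-(g ω)).toENNReal ∂μ := by
    rw [← lintegral_add_right _ hmeas, ← lintegral_congr hpt,
      lintegral_add_right _ measurable_const]
    simp
  unfold integralE
  simp only [hpos]
  generalize ∫⁻ ω, (g ω).toENNReal ∂μ = A at *
  generalize ∫⁻ ω, (-(g ω)).toENNReal ∂μ = N at *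
  generalize ∫⁻ ω, (g ω + b).toENNReal ∂μ = C at *
  have hN : N ≠ ⊤ := ne_top_of_le_ne_top ENNReal.ofReal_ne_top hneg
  lift N to NNReal using hN
  have hbE : ((ENNReal.ofReal b : ℝ≥0∞) : EReal) = b := by
    rw [EReal.coe_ennreal_ofReal, max_eq_left hb]
  rcases eq_or_ne C ⊤ with hC | hC
  · have hA : A = ⊤ := by
      by_contra hA
      rw [hC, top_add] at hsum
      exact ENNReal.add_ne_top.2 ⟨hA, ENNReal.ofReal_ne_top⟩ hsum
    rw [hA, hC]
    rfl
  · have hA : A ≠ ⊤ := fun hA => by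
      rw [hA, top_add] at hsum
      exact ENNReal.add_ne_top.2 ⟨hC, ENNReal.coe_ne_top⟩ hsum.symm
    lift A to NNReal using hA
    lift C to NNReal using hC
    rw [ENNReal.ofReal, ← ENNReal.coe_add, ← ENNReal.coe_add, ENNReal.coe_inj] at hsum
    have hsum' : (A : ℝ) + b = C + N := by
      rw [← Real.coe_toNNReal b hb]; exact_mod_cast hsum
    simp only [EReal.coe_nnreal_eq_coe_real]
    rw [← EReal.coe_sub, ← EReal.coe_sub, EReal.coe_eq_coe_iff]
    linarith

omit [Fintype X] [Nonempty X] [DecidableEq X] in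
lemma integralE_mono [IsProbabilityMeasure μ] {g h : Path X → EReal} (hg : Measurable g)
    (hh : Measurable h) {b : ℝ} (hgb : ∀ ω, (b : EReal) ≤ g ω) (hgh : ∀ ω, g ω ≤ h ω) :
    integralE μ g ≤ integralE μ h := by
  have hb' : ((-|b| : ℝ) : EReal) ≤ b := EReal.coe_le_coe_iff.2 (neg_abs_le b)
  have hgb' : ∀ ω, ((-|b| : ℝ) : EReal) ≤ g ω := fun ω => hb'.trans (hgb ω)
  rw [integralE_eq hg (abs_nonneg b) hgb',
    integralE_eq hh (abs_nonneg b) fun ω => (hgb' ω).trans (hgh ω)]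
  refine EReal.sub_le_sub (EReal.coe_ennreal_le_coe_ennreal_iff.2 ?_) le_rfl
  exact lintegral_mono fun ω => EReal.toENNReal_le_toENNReal (add_le_add_left (hgh ω) _)

lemma IsTreeMeasure.integralE_prefixList (hμ : IsTreeMeasure p s μ) {ψ : List X → ℝ} {b : ℝ}
    (hψ : ∀ t, b ≤ ψ t) (n : ℕ) :
    integralE μ (fun ω => (ψ (prefixList ω (s.length + n)) : EReal)) =
      ((expStep p)^[n] ψ s : ℝ) := by
  have := hμ.1
  have hψ' : ∀ t, 0 ≤ ψ t + |b| := fun t => by linarith [neg_abs_le b, hψ t]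
  rw [integralE_eq (measurable_comp_prefixList (fun t => (ψ t : EReal)) _) (abs_nonneg b)
    fun ω => EReal.coe_le_coe_iff.2 ((neg_abs_le b).trans (hψ _))]
  have h := hμ.lintegral_prefixList hψ' n
  rw [iterate_expStep_add_const] at h
  have hnn := iterate_expStep_nonneg p hψ' n s
  rw [iterate_expStep_add_const] at hnn
  simp only [← EReal.coe_add, EReal.toENNReal_of_ne_top (EReal.coe_ne_top _), EReal.toReal_coe]
  rw [h, EReal.coe_ennreal_ofReal, max_eq_left hnn, ← EReal.coe_sub, add_sub_cancel_right]

end Measure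

section UpperBound

lemma coe_toReal_truncation (x : EReal) (c d : ℝ) :
    (((x ⊔ c) ⊓ d).toReal : EReal) = (x ⊔ c) ⊓ d := by
  refine EReal.coe_toReal ?_ ?_
  · exact ne_top_of_le_ne_top (EReal.coe_ne_top d) inf_le_right
  · refine ne_bot_of_le_ne_bot (EReal.coe_ne_bot (c ⊓ d)) ?_
    exact le_inf ((EReal.coe_le_coe_iff.2 inf_le_left).trans le_sup_right)
      (EReal.coe_le_coe_iff.2 inf_le_right)

lemma tendsto_toENNReal_add {ι : Type*} {l : Filter ι} {g : ι → EReal} {x : EReal}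
    (h : Tendsto g l (𝓝 x)) (b : ℝ) :
    Tendsto (fun i => (g i + b).toENNReal) l (𝓝 (x + b).toENNReal) := by
  refine (EReal.continuous_toENNReal.tendsto _).comp ?_
  exact (EReal.continuousAt_add (p := (x, (b : EReal))) (Or.inr (EReal.coe_ne_bot b))
    (Or.inr (EReal.coe_ne_top b))).tendsto.comp (h.prodMk_nhds tendsto_const_nhds)

variable {P : ImpreciseTree X} {Q : UpperExpTree X} {p : PreciseTree X} {s : List X}
  {μ : Measure (Path X)}

omit [DecidableEq X] in
lemma iterate_expStep_le_of_isSupermart (hagree : Agree P Q) (hp : Compatible p P)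
    {M : List X → ℝ} (hM : IsSupermart Q M) (n : ℕ) : (expStep p)^[n] M ≤ M :=
  (expStep_mono p).antitone_iterate_of_map_le ((expStep_le_upperStep hagree hp M).trans hM)
    (Nat.zero_le n)

/-- A supermartingale inequality of Fatou type. -/
lemma IsTreeMeasure.integralE_le_of_isSupermart (hμ : IsTreeMeasure p s μ)
    (hagree : Agree P Q) (hp : Compatible p P) {h : Path X → EReal} (hh : Measurable h)
    {a : ℝ} (ha : ∀ ω, (a : EReal) ≤ h ω) {M : List X → ℝ} (hM : IsSupermart Q M)
    {B : ℝ} (hB : ∀ t, B ≤ M t)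
    (hlim : ∀ ω ∈ cyl s, h ω ≤ liminf (fun k => (M (prefixList ω k) : EReal)) atTop) :
    integralE μ h ≤ M s := by
  have := hμ.1
  obtain ⟨b, hb, hba, hbB⟩ : ∃ b : ℝ, 0 ≤ b ∧ -b ≤ a ∧ -b ≤ B :=
    ⟨|a| + |B|, by positivity, by linarith [neg_abs_le a, abs_nonneg B],
      by linarith [neg_abs_le B, abs_nonneg a]⟩
  have hMb : ∀ t, 0 ≤ M t + b := fun t => by linarith [hB t]
  rw [integralE_eq hh hb fun ω => (EReal.coe_le_coe_iff.2 hba).trans (ha ω)]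
  have hF : Monotone fun x : EReal => (x + b).toENNReal :=
    fun x y hxy => EReal.toENNReal_le_toENNReal (add_le_add_left hxy _)
  have key : ∫⁻ ω, (h ω + b).toENNReal ∂μ ≤ ENNReal.ofReal (M s + b) := by
    calc ∫⁻ ω, (h ω + b).toENNReal ∂μ
        ≤ ∫⁻ ω, liminf (fun n => ENNReal.ofReal (M (prefixList ω (s.length + n)) + b)) atTop ∂μ := by
          refine lintegral_mono_ae ?_
          filter_upwards [hμ.ae_mem_cyl] with ω hω
          refine (hF (hlim ω hω)).trans_eq ?_
          rw [← liminf_nat_add _ s.length]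
          refine (hF.map_liminf_of_continuousAt _ (tendsto_toENNReal_add tendsto_id b)).trans ?_
          congr 1
          ext n
          simp only [Function.comp, ← EReal.coe_add,
            EReal.toENNReal_of_ne_top (EReal.coe_ne_top _), EReal.toReal_coe, add_comm n]
      _ ≤ liminf (fun n => ∫⁻ ω, ENNReal.ofReal (M (prefixList ω (s.length + n)) + b) ∂μ) atTop :=
          lintegral_liminf_le fun n =>
            measurable_comp_prefixList (fun t => ENNReal.ofReal (M t + b)) _
      _ ≤ liminf (fun _ : ℕ => ENNReal.ofReal (M s + b)) atTop := by
          refine liminf_le_liminf (Eventually.of_forall fun n => ?_)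
          rw [hμ.lintegral_prefixList hMb, iterate_expStep_add_const]
          exact ENNReal.ofReal_le_ofReal (add_le_add_left
            (iterate_expStep_le_of_isSupermart hagree hp hM n s) _)
      _ = ENNReal.ofReal (M s + b) := liminf_const _
  refine (EReal.sub_le_sub (EReal.coe_ennreal_le_coe_ennreal_iff.2 key) le_rfl).trans_eq ?_
  rw [EReal.coe_ennreal_ofReal, max_eq_left (hMb s), ← EReal.coe_sub, add_sub_cancel_right]

omit [Fintype X] [Nonempty X] [DecidableEq X] in
lemma integralE_le_iSup_inf [IsProbabilityMeasure μ] {g : Path X → EReal} (hg : Measurable g)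
    {c : ℝ} (hc : ∀ ω, (c : EReal) ≤ g ω) :
    integralE μ g ≤ ⨆ n : ℕ, integralE μ fun ω => g ω ⊓ ((n : ℝ) : EReal) := by
  have hcb : ((-|c| : ℝ) : EReal) ≤ c := EReal.coe_le_coe_iff.2 (neg_abs_le c)
  have hgb : ∀ ω, ((-|c| : ℝ) : EReal) ≤ g ω := fun ω => hcb.trans (hc ω)
  have hnb : ∀ (n : ℕ) ω, ((-|c| : ℝ) : EReal) ≤ g ω ⊓ ((n : ℝ) : EReal) := fun n ω =>
    le_inf (hgb ω) (EReal.coe_le_coe_iff.2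
      ((neg_nonpos.2 (abs_nonneg c)).trans n.cast_nonneg))
  have hmeas : ∀ n : ℕ, Measurable fun ω => g ω ⊓ ((n : ℝ) : EReal) :=
    fun n => hg.inf measurable_const
  have hmono : Monotone fun (n : ℕ) ω => (g ω ⊓ ((n : ℝ) : EReal) + |c|).toENNReal := by
    intro m n hmn ω
    refine EReal.toENNReal_le_toENNReal (add_le_add_left (inf_le_inf_left _ ?_) _)
    exact EReal.coe_le_coe_iff.2 (Nat.cast_le.2 hmn)
  have hlim : Tendsto (fun n : ℕ => integralE μ fun ω => g ω ⊓ ((n : ℝ) : EReal)) atTop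
      (𝓝 (integralE μ g)) := by
    rw [integralE_eq hg (abs_nonneg c) hgb]
    simp only [fun n => integralE_eq (μ := μ) (hmeas n) (abs_nonneg c) (hnb n)]
    have hL : Tendsto (fun n : ℕ => ∫⁻ ω, (g ω ⊓ ((n : ℝ) : EReal) + |c|).toENNReal ∂μ) atTop
        (𝓝 (∫⁻ ω, (g ω + |c|).toENNReal ∂μ)) := by
      refine lintegral_tendsto_of_tendsto_of_monotone
        (fun n => (measurable_ereal_toENNReal.comp
          ((hmeas n).add measurable_const)).aemeasurable)
        (Eventually.of_forall fun ω m n hmn => hmono hmn ω) (Eventually.of_forall fun ω => ?_)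
      refine tendsto_toENNReal_add ?_ _
      have htop : Tendsto (fun n : ℕ => ((n : ℝ) : EReal)) atTop (𝓝 ⊤) :=
        EReal.tendsto_coe_nhds_top_iff.2 tendsto_natCast_atTop_atTop
      simpa using (tendsto_const_nhds (x := g ω)).min htop
    have hE := (continuous_coe_ennreal_ereal.tendsto _).comp hL
    simp only [sub_eq_add_neg]
    refine (EReal.continuousAt_add (p := (_, (-(|c| : ℝ) : EReal))) (Or.inr ?_)
      (Or.inr ?_)).tendsto.comp (hE.prodMk_nhds tendsto_const_nhds)
    · exact EReal.coe_ne_bot (-|c|)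
    · exact EReal.coe_ne_top (-|c|)
  exact le_of_tendsto hlim (Eventually.of_forall fun n => le_iSup
    (fun n : ℕ => integralE μ fun ω => g ω ⊓ ((n : ℝ) : EReal)) n)

lemma IsTreeMeasure.upperInt_le_gtUE (hμ : IsTreeMeasure p s μ) (hagree : Agree P Q)
    (hp : Compatible p P) {f : Path X → EReal} (hf : Measurable f) :
    upperInt μ f ≤ gtUE Q f s := by
  have := hμ.1
  refine le_iInf fun c => ?_
  have hfc : Measurable fun ω => f ω ⊔ (c : EReal) := hf.sup measurable_const
  calc upperInt μ f ≤ integralE μ fun ω => f ω ⊔ (c : EReal) :=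
        sInf_le ⟨_, hfc, ⟨c, fun ω => le_sup_right⟩, fun ω => le_sup_left, rfl⟩
    _ ≤ ⨆ n : ℕ, integralE μ fun ω => (f ω ⊔ (c : EReal)) ⊓ ((n : ℝ) : EReal) :=
        integralE_le_iSup_inf hfc fun ω => le_sup_right
    _ ≤ gtBB Q (fun ω => f ω ⊔ (c : EReal)) s := by
        refine iSup_le fun n => le_iSup_of_le (n : ℝ) (le_sInf ?_)
        rintro _ ⟨M, hM, ⟨B, hB⟩, hlim, rfl⟩
        simp only [coe_toReal_truncation] at hlim
        refine hμ.integralE_le_of_isSupermart hagree hp (hfc.inf measurable_const)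
          (a := c ⊓ n) (fun ω => ?_) hM hB hlim
        exact le_inf ((EReal.coe_le_coe_iff.2 inf_le_left).trans le_sup_right)
          (EReal.coe_le_coe_iff.2 inf_le_right)

end UpperBound

section Semicontinuity

omit [Fintype X] [Nonempty X] [DecidableEq X] in
lemma eventually_cyl_subset [TopologicalSpace X] {U : Set (Path X)}
    (hU : IsOpen U) {ω : Path X} (hω : ω ∈ U) :
    ∀ᶠ n in atTop, cyl (prefixList ω n) ⊆ U := by
  obtain ⟨I, u, hu, hsub⟩ := isOpen_pi_iff.1 hU ω hω
  filter_upwards [eventually_gt_atTop (I.sup id)] with n hn ω' hω'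
  refine hsub fun i hi => ?_
  have hin : i < n := (Finset.le_sup (f := id) hi).trans_lt hn
  have h : prefixList ω' n = prefixList ω n := by
    have h' : prefixList ω' (prefixList ω n).length = prefixList ω n := hω'
    rwa [length_prefixList] at h'
  rw [List.map_inj_left.1 h i (List.mem_range.2 hin)]
  exact (hu i hi).2

omit [Nonempty X] [DecidableEq X] in
lemma measurableSet_of_isOpen_path [TopologicalSpace X] {U : Set (Path X)} (hU : IsOpen U) :
    MeasurableSet U := by
  have h : U = ⋃ (t : List X) (_ : cyl t ⊆ U), cyl t := by
    refine Set.Subset.antisymm (fun ω hω => ?_) (Set.iUnion₂_subset fun _ h => h)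
    obtain ⟨n, hn⟩ := (eventually_cyl_subset hU hω).exists
    exact Set.mem_iUnion₂.2 ⟨_, hn, mem_cyl_prefixList ω n⟩
  rw [h]
  exact MeasurableSet.iUnion fun t => MeasurableSet.iUnion fun _ => measurableSet_cyl t

omit [Nonempty X] [DecidableEq X] in
lemma USC.measurable [TopologicalSpace X] [DiscreteTopology X] {f : Path X → EReal}
    (hf : USC f) : Measurable f := by
  refine measurable_of_Iio fun a => ?_
  have h : f ⁻¹' Set.Iio a = ⋃ (q : ℚ) (_ : ((q : ℝ) : EReal) < a),
      {ω | f ω < ((q : ℝ) : EReal)} := by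
    ext ω
    simp only [Set.mem_preimage, Set.mem_Iio, Set.mem_iUnion, exists_prop]
    rw [EReal.lt_iff_exists_rat_btwn]
    exact ⟨fun ⟨q, h₁, h₂⟩ => ⟨q, h₂, h₁⟩, fun ⟨q, h₂, h₁⟩ => ⟨q, h₁, h₂⟩⟩
  rw [h]
  exact MeasurableSet.iUnion fun q => MeasurableSet.iUnion fun _ =>
    measurableSet_of_isOpen_path (hf q)

variable {P : ImpreciseTree X} {Q : UpperExpTree X} {s : List X}
  {Pm : PreciseTree X → List X → Measure (Path X)}

omit [DecidableEq X] in
/-- The game-theoretic upper expectation of a variable dominated by the values `φ` at all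
prefixes is at most any backward recursion started from `φ`. -/
lemma gtUE_le_iterate_upperStep (hagree : Agree P Q) {f : Path X → EReal} {φ : List X → ℝ}
    (hfφ : ∀ ω n, f ω ≤ (φ (prefixList ω n) : EReal))
    (hφ : ∀ t x, φ (t ++ [x]) ≤ φ t) (hφb : ∀ t, -(t.length : ℝ) ≤ φ t) (k : ℕ) :
    gtUE Q f s ≤ ((upperStep Q)^[k] φ s : ℝ) := by
  set L := s.length + k with hL
  let ψ : List X → ℝ := fun t => φ t ⊔ -(L : ℝ)
  have hψ : upperStep Q ψ ≤ ψ :=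
    upperStep_le_self hagree fun t x => sup_le_sup_right (hφ t x) _
  refine iInf_le_of_le (-(L : ℝ)) (iSup_le fun c => sInf_le_of_le
    ⟨_, isSupermart_iterate hψ L, ⟨-(L : ℝ), fun t => ?_⟩, fun ω _ => ?_, rfl⟩ ?_)
  · have h := (upperStep_mono hagree).iterate (L - t.length)
      (show (fun _ => -(L : ℝ)) ≤ ψ from fun _ => le_sup_right) t
    rwa [iterate_upperStep_const hagree] at h
  · rw [coe_toReal_truncation]
    refine le_liminf_of_le (by isBoundedDefault) ?_
    filter_upwards [eventually_ge_atTop L] with n hn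
    rw [length_prefixList, Nat.sub_eq_zero_of_le hn]
    refine inf_le_left.trans (sup_le ((hfφ ω n).trans ?_) ?_)
    · exact EReal.coe_le_coe_iff.2 le_sup_left
    · exact EReal.coe_le_coe_iff.2 le_sup_right
  · rw [show L - s.length = k by omega]
    refine EReal.coe_le_coe_iff.2 (iterate_upperStep_congr Q k s fun u hu => ?_).le
    refine sup_eq_left.2 ((neg_le_neg ?_).trans (hφb u))
    rw [hu]

omit [DecidableEq X] in
/-- The limit of an increasing backward recursion bounds the game-theoretic upper expectation. -/
lemma gtG_le_iSup_iterate_upperStep (hagree : Agree P Q) {h : Path X → ℝ} {φ : List X → ℝ}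
    (hφ : ∀ t x, φ t ≤ φ (t ++ [x])) {A B : ℝ} (hA : ∀ t, A ≤ φ t) (hB : ∀ t, φ t ≤ B)
    (hlim : ∀ ω, (h ω : EReal) ≤ liminf (fun n => (φ (prefixList ω n) : EReal)) atTop) :
    gtG Q h s ≤ ⨆ k, (((upperStep Q)^[k] φ s : ℝ) : EReal) := by
  have hle := le_upperStep_self hagree hφ
  have hbdd : ∀ t, BddAbove (Set.range fun k => (upperStep Q)^[k] φ t) := by
    refine fun t => ⟨B, ?_⟩
    rintro _ ⟨k, rfl⟩
    refine ((upperStep_mono hagree).iterate k (show φ ≤ fun _ => B from hB) t).trans_eq ?_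
    rw [iterate_upperStep_const hagree]
  have hφM : ∀ t, φ t ≤ ⨆ k, (upperStep Q)^[k] φ t := fun t => le_ciSup (hbdd t) 0
  refine sInf_le_of_le ⟨_, isSupermart_iSup_iterate hagree hle hB,
    ⟨A, fun t => (hA t).trans (hφM t)⟩, fun ω _ => (hlim ω).trans ?_, rfl⟩ ?_
  · exact liminf_le_liminf (Eventually.of_forall fun n => EReal.coe_le_coe_iff.2 (hφM _))
  · have hmono : Monotone fun k => (upperStep Q)^[k] φ s := fun _ _ h =>
      (upperStep_mono hagree).monotone_iterate_of_le_map hle h s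
    exact le_of_tendsto (EReal.tendsto_coe.2 (tendsto_atTop_ciSup hmono (hbdd s)))
      (Eventually.of_forall fun k => le_iSup (fun k => (((upperStep Q)^[k] φ s : ℝ) : EReal)) k)

variable {p : PreciseTree X} {μ : Measure (Path X)}

lemma IsTreeMeasure.iterate_expStep_le_upperInt (hμ : IsTreeMeasure p s μ) {ψ : List X → ℝ}
    {b : ℝ} (hψ : ∀ t, b ≤ ψ t) (n : ℕ) {f : Path X → EReal}
    (hf : ∀ ω, (ψ (prefixList ω (s.length + n)) : EReal) ≤ f ω) :
    (((expStep p)^[n] ψ s : ℝ) : EReal) ≤ upperInt μ f := by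
  have := hμ.1
  refine le_sInf ?_
  rintro _ ⟨g, hg, -, hfg, rfl⟩
  rw [← hμ.integralE_prefixList hψ n]
  exact integralE_mono (measurable_comp_prefixList (fun t => (ψ t : EReal)) _) hg
    (fun ω => EReal.coe_le_coe_iff.2 (hψ _)) fun ω => (hf ω).trans (hfg ω)

lemma IsTreeMeasure.le_upperInt_of_tendsto (hμ : IsTreeMeasure p s μ) {φ : List X → ℝ} {d : ℝ}
    (hd : ∀ t, φ t ≤ d) {f : Path X → EReal}
    (hlim : ∀ ω, Tendsto (fun n => (φ (prefixList ω n) : EReal)) atTop (𝓝 (f ω)))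
    {a : ℝ} (ha : ∀ n, a ≤ (expStep p)^[n] φ s) : (a : EReal) ≤ upperInt μ f := by
  have := hμ.1
  refine le_sInf ?_
  rintro _ ⟨g, hg, ⟨B, hB⟩, hfg, rfl⟩
  have hgb : ∀ ω, ((-|B| : ℝ) : EReal) ≤ g ω :=
    fun ω => (EReal.coe_le_coe_iff.2 (neg_abs_le B)).trans (hB ω)
  rw [integralE_eq hg (abs_nonneg B) hgb]
  generalize |B| = b
  have hcoe : ∀ r : ℝ, ((r : EReal) + b).toENNReal = ENNReal.ofReal (r + b) := fun r => by
    rw [← EReal.coe_add, EReal.toENNReal_of_ne_top (EReal.coe_ne_top _), EReal.toReal_coe]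
  have hT : Tendsto
      (fun n => ∫⁻ ω, ((φ (prefixList ω (n + s.length)) : EReal) + b).toENNReal ∂μ) atTop
      (𝓝 (∫⁻ ω, (f ω + b).toENNReal ∂μ)) := by
    refine tendsto_lintegral_of_dominated_convergence (fun _ => ENNReal.ofReal (d + b))
      (fun n => measurable_comp_prefixList (fun t => ((φ t : EReal) + b).toENNReal) _)
      (fun n => Eventually.of_forall fun ω => ?_) (by simp) (Eventually.of_forall fun ω =>
        tendsto_toENNReal_add ((tendsto_add_atTop_iff_nat s.length).2 (hlim ω)) b)
    simp only [hcoe]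
    exact ENNReal.ofReal_le_ofReal (add_le_add_left (hd _) _)
  have hle : ENNReal.ofReal (a + b) ≤ ∫⁻ ω, (g ω + b).toENNReal ∂μ := by
    refine (ge_of_tendsto hT (Eventually.of_forall fun n => ?_)).trans
      (lintegral_mono fun ω => EReal.toENNReal_le_toENNReal (add_le_add_left (hfg ω) _))
    have h := hμ.lintegral_prefixList (ψ := fun t => (φ t + b) ⊔ 0) (fun t => le_sup_right) n
    simp only [hcoe, add_comm n]
    calc ENNReal.ofReal (a + b) ≤ ENNReal.ofReal ((expStep p)^[n] (fun t => φ t + b) s) := by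
          rw [iterate_expStep_add_const]
          exact ENNReal.ofReal_le_ofReal (add_le_add_left (ha n) _)
      _ ≤ ENNReal.ofReal ((expStep p)^[n] (fun t => (φ t + b) ⊔ 0) s) :=
          ENNReal.ofReal_le_ofReal ((expStep_mono p).iterate n (fun t => le_sup_left) s)
      _ = _ := by
          rw [← h]
          simp [ENNReal.ofReal_max]
  rw [EReal.le_sub_iff_add_le (Or.inl (EReal.coe_ne_bot b)) (Or.inl (EReal.coe_ne_top b)),
    ← EReal.coe_add]
  refine le_trans ?_ (EReal.coe_ennreal_le_coe_ennreal_iff.2 hle)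
  rw [EReal.coe_ennreal_ofReal]
  exact EReal.coe_le_coe_iff.2 (le_max_left _ _)

lemma muUE_le_gtUE (hPm : ∀ (p : PreciseTree X) (s : List X), IsTreeMeasure p s (Pm p s))
    (hagree : Agree P Q) {f : Path X → EReal} (hf : Measurable f) :
    muUE Pm P f s ≤ gtUE Q f s :=
  iSup₂_le fun p hp => (hPm p s).upperInt_le_gtUE hagree hp hf

lemma gtUE_le_muUE_of_usc [TopologicalSpace X] [DiscreteTopology X]
    (hPm : ∀ (p : PreciseTree X) (s : List X), IsTreeMeasure p s (Pm p s))
    (hagree : Agree P Q) {f : Path X → EReal} (hf : USC f) {B : ℝ}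
    (hB : ∀ ω, f ω ≤ (B : EReal)) : gtUE Q f s ≤ muUE Pm P f s := by
  let φ : List X → ℝ := fun t =>
    (((⨆ ω ∈ cyl t, f ω) ⊔ ((-(t.length : ℝ) : ℝ) : EReal)) ⊓ ((B ⊔ 0 : ℝ) : EReal)).toReal
  have hcoe : ∀ t, (φ t : EReal) =
      ((⨆ ω ∈ cyl t, f ω) ⊔ ((-(t.length : ℝ) : ℝ) : EReal)) ⊓ ((B ⊔ 0 : ℝ) : EReal) :=
    fun t => coe_toReal_truncation _ _ _
  have hanti : ∀ t x, φ (t ++ [x]) ≤ φ t := by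
    intro t x
    rw [← EReal.coe_le_coe_iff, hcoe, hcoe]
    refine inf_le_inf_right _ (sup_le_sup ?_ (EReal.coe_le_coe_iff.2 ?_))
    · exact biSup_mono (cyl_append_subset t x)
    · simp
  have hlow : ∀ t, -(t.length : ℝ) ≤ φ t := by
    intro t
    rw [← EReal.coe_le_coe_iff, hcoe]
    refine le_inf le_sup_right (EReal.coe_le_coe_iff.2 (le_sup_of_le_right ?_))
    exact neg_nonpos.2 (Nat.cast_nonneg _)
  have hup : ∀ t, φ t ≤ B ⊔ 0 := by
    intro t
    rw [← EReal.coe_le_coe_iff, hcoe]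
    exact inf_le_right
  have hfφ : ∀ ω n, f ω ≤ (φ (prefixList ω n) : EReal) := by
    intro ω n
    rw [hcoe]
    exact le_inf (le_sup_of_le_left (le_iSup₂ (f := fun ω _ => f ω) ω (mem_cyl_prefixList ω n)))
      ((hB ω).trans (EReal.coe_le_coe_iff.2 le_sup_left))
  have hlim : ∀ ω, Tendsto (fun n => (φ (prefixList ω n) : EReal)) atTop (𝓝 (f ω)) := by
    intro ω
    refine tendsto_order.2 ⟨fun a ha => Eventually.of_forall fun n => ha.trans_le (hfφ ω n),
      fun a ha => ?_⟩
    obtain ⟨r, hr, hra⟩ := EReal.lt_iff_exists_real_btwn.1 ha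
    filter_upwards [eventually_cyl_subset (hf r) hr,
      tendsto_natCast_atTop_atTop.eventually_ge_atTop (-r)] with n hn hnr
    refine lt_of_le_of_lt ?_ hra
    rw [hcoe, length_prefixList]
    refine inf_le_of_left_le (sup_le (iSup₂_le fun ω' hω' => (hn hω').le) ?_)
    exact EReal.coe_le_coe_iff.2 (by linarith)
  by_contra! hlt
  obtain ⟨a, ha, hag⟩ := EReal.lt_iff_exists_real_btwn.1 hlt
  obtain ⟨p, hp, hap⟩ := exists_compatible_le_iterate_expStep hagree
    (upperStep_le_self hagree hanti) s (a := a) fun k => EReal.coe_le_coe_iff.1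
      (hag.le.trans (gtUE_le_iterate_upperStep hagree hfφ hanti hlow k))
  exact ha.not_ge (((hPm p s).le_upperInt_of_tendsto hup hlim hap).trans
    (le_iSup₂ (f := fun p (_ : Compatible p P) => upperInt (Pm p s) f) p hp))

lemma gtUE_le_muUE_of_lsc [TopologicalSpace X] [DiscreteTopology X]
    (hPm : ∀ (p : PreciseTree X) (s : List X), IsTreeMeasure p s (Pm p s))
    (hagree : Agree P Q) {f : Path X → EReal} (hf : USC fun ω => -(f ω)) {B : ℝ}
    (hB : ∀ ω, (B : EReal) ≤ f ω) : gtUE Q f s ≤ muUE Pm P f s := by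
  refine iInf_le_of_le B (iSup_le fun c => ?_)
  let φ : List X → ℝ := fun t => (((⨅ ω ∈ cyl t, f ω) ⊔ (B : EReal)) ⊓ (c : EReal)).toReal
  have hcoe : ∀ t, (φ t : EReal) = ((⨅ ω ∈ cyl t, f ω) ⊔ (B : EReal)) ⊓ (c : EReal) :=
    fun t => coe_toReal_truncation _ _ _
  have hmono : ∀ t x, φ t ≤ φ (t ++ [x]) := by
    intro t x
    rw [← EReal.coe_le_coe_iff, hcoe, hcoe]
    exact inf_le_inf_right _ (sup_le_sup_right (biInf_mono (cyl_append_subset t x)) _)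
  have hlow : ∀ t, B ⊓ c ≤ φ t := by
    intro t
    rw [← EReal.coe_le_coe_iff, hcoe]
    exact le_inf (le_sup_of_le_right (EReal.coe_le_coe_iff.2 inf_le_left))
      (EReal.coe_le_coe_iff.2 inf_le_right)
  have hup : ∀ t, φ t ≤ c := by
    intro t
    rw [← EReal.coe_le_coe_iff, hcoe]
    exact inf_le_right
  have hφf : ∀ ω n, (φ (prefixList ω n) : EReal) ≤ f ω := by
    intro ω n
    rw [hcoe]
    exact inf_le_of_left_le (sup_le (iInf₂_le ω (mem_cyl_prefixList ω n)) (hB ω))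
  refine (gtG_le_iSup_iterate_upperStep hagree hmono hlow hup fun ω => ?_).trans
    (iSup_le fun k => ?_)
  · rw [coe_toReal_truncation, sup_eq_left.2 (hB ω)]
    refine le_of_forall_lt fun a ha => ?_
    obtain ⟨r, har, hr⟩ := EReal.lt_iff_exists_real_btwn.1 ha
    refine har.trans_le (le_liminf_of_le (by isBoundedDefault) ?_)
    have hrf : -(f ω) < ((-r : ℝ) : EReal) := EReal.neg_lt_neg_iff.2 (hr.trans_le inf_le_left)
    filter_upwards [eventually_cyl_subset (hf (-r)) hrf] with n hn
    rw [hcoe]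
    refine le_inf (le_sup_of_le_left (le_iInf₂ fun ω' hω' => ?_)) (hr.le.trans inf_le_right)
    exact (EReal.neg_lt_neg_iff.1 (hn hω')).le
  · obtain ⟨p, hp, h⟩ := exists_iterate_expStep_eq hagree φ k s
    rw [← h]
    exact ((hPm p s).iterate_expStep_le_upperInt hlow k fun ω => hφf ω _).trans
      (le_iSup₂ (f := fun p (_ : Compatible p P) => upperInt (Pm p s) f) p hp)

end Semicontinuity

theorem stmt10 [TopologicalSpace X] [DiscreteTopology X]
    (P : ImpreciseTree X) (Q : UpperExpTree X)
    (Pm : PreciseTree X → List X → Measure (Path X))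
    (hPm : ∀ (p : PreciseTree X) (s : List X), IsTreeMeasure p s (Pm p s))
    (hagree : Agree P Q) (s : List X) (f : Path X → EReal)
    (h : (USC f ∧ ∃ B : ℝ, ∀ ω, f ω ≤ (B : EReal)) ∨
         (USC (fun ω => -(f ω)) ∧ ∃ B : ℝ, ∀ ω, (B : EReal) ≤ f ω)) :
    muUE Pm P f s = gtUE Q f s := by
  rcases h with ⟨hf, B, hB⟩ | ⟨hf, B, hB⟩
  · exact (muUE_le_gtUE hPm hagree hf.measurable).antisymm
      (gtUE_le_muUE_of_usc hPm hagree hf hB)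
  · have hmeas : Measurable f := by
      have h := hf.measurable.neg
      simpa only [Pi.neg_def, neg_neg] using h
    exact (muUE_le_gtUE hPm hagree hmeas).antisymm (gtUE_le_muUE_of_lsc hPm hagree hf hB)

end UEPaper
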